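/- Let c, d : [0,∞)² → [0,∞) and set Z = {(r,s) ∈ (0,∞)² : d(r,s) = 0}. Assume that d(r,s) > 0 for some r, s > 0 and that the multiplicative subgroup of (0,∞) generated by the set {r/s : (r,s) ∈ Z} is dense in (0,∞). Let φ, ψ : ℝ → ℝ be nontrivial real-valued characteristic functions of probability measures on ℝ satisfying φ(rt)·φ(st) = φ(c(r,s)·t)·ψ(d(r,s)·t) for all r, s ≥ 0 and all t ∈ ℝ. Then there exist p ∈ (0,2] and A, B > 0 such that φ(t) = exp(−A|t|^p) and ψ(t) = exp(−B|t|^p) for all t ∈ ℝ, and A·(r^p + s^p − c(r,s)^p) = B·d(r,s)^p for all r, s ≥ 0. -/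

import Mathlib

open MeasureTheory

/-- The characteristic function of a measure `μ` on `ℝ`. -/
noncomputable def charFunOf (μ : Measure ℝ) (t : ℝ) : ℂ :=
  ∫ x, Complex.exp (t * x * Complex.I) ∂μ

lemma le_comp_mul_of_bounded_of_harmonic {G : ℝ → ℝ} {a b α β K : ℝ} (ha : 0 < a) (hb : 0 < b)
    (hα : 0 < α) (hβ : 0 < β) (hαβ : α + β = 1)
    (hG : ∀ t, 0 < t → G t = α * G (a * t) + β * G (b * t))
    (hK : ∀ t, 0 < t → |G t| ≤ K) {t : ℝ} (ht : 0 < t) : G t ≤ G (a * t) := by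
  by_contra! hlt
  set g : ℝ → ℝ := fun t => G t - G (a * t) with hg
  have hgK : ∀ t, 0 < t → g t ≤ 2 * K := by
    intro t ht
    have h1 := abs_le.1 (hK t ht)
    have h2 := abs_le.1 (hK (a * t) (by positivity))
    simp only [hg]
    linarith
  have hbdd : BddAbove (g '' Set.Ioi 0) := by
    refine ⟨2 * K, ?_⟩
    rintro _ ⟨x, hx, rfl⟩
    exact hgK x hx
  set S := sSup (g '' Set.Ioi 0) with hS
  have hle : ∀ t, 0 < t → g t ≤ S := fun t ht => le_csSup hbdd ⟨t, ht, rfl⟩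
  have hSpos : 0 < S := lt_of_lt_of_le (by simp only [hg]; linarith) (hle t ht)
  obtain ⟨N, hN⟩ := exists_nat_gt (2 * K / (S / 2))
  rw [div_lt_iff₀ (by positivity)] at hN
  have hα1 : α ≤ 1 := by linarith
  set ε := α ^ N * (S / 2) with hε
  have hεpos : 0 < ε := by positivity
  obtain ⟨_, ⟨x, hx, rfl⟩, hxS⟩ := exists_lt_of_lt_csSup
    (⟨g t, t, ht, rfl⟩ : (g '' Set.Ioi 0).Nonempty) (show S - ε < S by linarith)
  rw [Set.mem_Ioi] at hx
  have hharm : ∀ t, 0 < t → g t = α * g (a * t) + β * g (b * t) := by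
    intro t ht
    simp only [hg]
    have h1 := hG t ht
    have h2 := hG (a * t) (by positivity)
    rw [show b * (a * t) = a * (b * t) by ring] at h2
    linarith
  have hstep : ∀ k : ℕ, α ^ k * (S - g (a ^ k * x)) ≤ ε := by
    intro k
    induction k with
    | zero => simp; linarith
    | succ k ih =>
      refine le_trans ?_ ih
      have h1 := hharm (a ^ k * x) (by positivity)
      have h2 := hle (b * (a ^ k * x)) (by positivity)
      rw [show a * (a ^ k * x) = a ^ (k + 1) * x by ring] at h1
      rw [pow_succ, mul_assoc]
      refine mul_le_mul_of_nonneg_left ?_ (by positivity)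
      have h3 := mul_le_mul_of_nonneg_left h2 hβ.le
      have h4 : S = α * S + β * S := by rw [← add_mul, hαβ, one_mul]
      linarith
  have hhalf : ∀ k, k < N → S / 2 ≤ g (a ^ k * x) := by
    intro k hk
    have h1 := hstep k
    have h2 : α ^ N ≤ α ^ k := pow_le_pow_of_le_one hα.le hα1 hk.le
    have h3 : ε ≤ α ^ k * (S / 2) := mul_le_mul_of_nonneg_right h2 (by positivity)
    have h4 := le_of_mul_le_mul_left (h1.trans h3) (by positivity)
    linarith
  have hsum : ∑ k ∈ Finset.range N, g (a ^ k * x) = G x - G (a ^ N * x) := by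
    have := Finset.sum_range_sub' (fun k => G (a ^ k * x)) N
    simp only [pow_zero, one_mul] at this
    rw [← this]
    refine Finset.sum_congr rfl fun k _ => ?_
    simp only [hg]
    rw [← mul_assoc, ← pow_succ']
  have hsum2 : (N : ℝ) * (S / 2) ≤ ∑ k ∈ Finset.range N, g (a ^ k * x) := by
    have := Finset.card_nsmul_le_sum (Finset.range N) (fun k => g (a ^ k * x)) (S / 2)
      (fun k hk => hhalf k (Finset.mem_range.1 hk))
    simpa using this
  have h1 := abs_le.1 (hK x hx)
  have h2 := abs_le.1 (hK (a ^ N * x) (by positivity))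
  linarith

/-- Choquet–Deny: a bounded function that is harmonic for a two-point measure is periodic. -/
lemma comp_mul_eq_of_bounded_of_harmonic {G : ℝ → ℝ} {a b α β K : ℝ} (ha : 0 < a) (hb : 0 < b)
    (hα : 0 < α) (hβ : 0 < β) (hαβ : α + β = 1)
    (hG : ∀ t, 0 < t → G t = α * G (a * t) + β * G (b * t))
    (hK : ∀ t, 0 < t → |G t| ≤ K) {t : ℝ} (ht : 0 < t) : G (a * t) = G t := by
  refine le_antisymm ?_ (le_comp_mul_of_bounded_of_harmonic ha hb hα hβ hαβ hG hK ht)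
  have := le_comp_mul_of_bounded_of_harmonic (G := fun t => -G t) (K := K) ha hb hα hβ hαβ
    (fun t ht => by rw [hG t ht]; ring) (fun t ht => by rw [abs_neg]; exact hK t ht) ht
  linarith

/-- A maximum principle: bounds on the window `[m * ε, ε]` propagate to `[m * ε, ∞)`. -/
lemma le_of_le_on_window_of_harmonic {G : ℝ → ℝ} {a b α β m ρ ε M : ℝ} (hm : 0 < m)
    (hma : m ≤ a) (hmb : m ≤ b) (haρ : a ≤ ρ) (hbρ : b ≤ ρ) (hρ : ρ < 1) (hε : 0 < ε)
    (hα : 0 ≤ α) (hβ : 0 ≤ β) (hαβ : α + β = 1)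
    (hG : ∀ t, 0 < t → G t = α * G (a * t) + β * G (b * t))
    (hM : ∀ t, m * ε ≤ t → t ≤ ε → G t ≤ M) {t : ℝ} (ht : m * ε ≤ t) : G t ≤ M := by
  have hρ0 : 0 < ρ := by linarith
  have key : ∀ n : ℕ, ∀ t, m * ε ≤ t → ρ ^ n * t ≤ ε → G t ≤ M := by
    intro n
    induction n with
    | zero => intro t h1 h2; exact hM t h1 (by simpa using h2)
    | succ n ih =>
      intro t h1 h2
      rcases le_or_gt t ε with h | h
      · exact hM t h1 h
      have ht0 : 0 < t := hε.trans h
      have aux : ∀ x, m ≤ x → x ≤ ρ → G (x * t) ≤ M := by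
        intro x hmx hxρ
        have hx0 : 0 ≤ x := hm.le.trans hmx
        refine ih _ (by gcongr) ?_
        calc ρ ^ n * (x * t) ≤ ρ ^ n * (ρ * t) := by gcongr
          _ = ρ ^ (n + 1) * t := by ring
          _ ≤ ε := h2
      rw [hG t ht0]
      calc α * G (a * t) + β * G (b * t) ≤ α * M + β * M := by
            gcongr
            · exact aux a hma haρ
            · exact aux b hmb hbρ
        _ = M := by rw [← add_mul, hαβ, one_mul]
  have ht0 : 0 < t := lt_of_lt_of_le (by positivity) ht
  obtain ⟨n, hn⟩ := exists_pow_lt_of_lt_one (div_pos hε ht0) hρ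
  exact key n t ht (by rw [lt_div_iff₀ ht0] at hn; exact hn.le)

lemma exists_rpow_add_rpow_eq_one {a b : ℝ} (ha : 0 < a) (ha1 : a < 1) (hb : 0 < b) (hb1 : b < 1) :
    ∃ p : ℝ, 0 < p ∧ a ^ p + b ^ p = 1 := by
  have hcont : Continuous fun p : ℝ => a ^ p + b ^ p :=
    (Real.continuous_const_rpow ha.ne').add (Real.continuous_const_rpow hb.ne')
  have hlim : Filter.Tendsto (fun p : ℝ => a ^ p + b ^ p) Filter.atTop (nhds 0) := by
    simpa using (tendsto_rpow_atTop_of_base_lt_one a (by linarith) ha1).add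
      (tendsto_rpow_atTop_of_base_lt_one b (by linarith) hb1)
  obtain ⟨q, hq, hq0⟩ := ((hlim.eventually (gt_mem_nhds (zero_lt_one' ℝ))).and
    (Filter.eventually_ge_atTop 0)).exists
  obtain ⟨p, hp, hpeq⟩ := intermediate_value_Icc' hq0 hcont.continuousOn
    (show (1 : ℝ) ∈ Set.Icc _ _ from ⟨hq.le, by norm_num⟩)
  refine ⟨p, lt_of_le_of_ne hp.1 ?_, hpeq⟩
  rintro rfl
  norm_num at hpeq

lemma div_rpow_add_one_eq {F : ℝ → ℝ} {a b p t : ℝ} (ha : 0 < a) (hb : 0 < b) (ht : 0 < t)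
    (hF : F t = F (a * t) / a + F (b * t) / b) :
    F t / t ^ (p + 1) = a ^ p * (F (a * t) / (a * t) ^ (p + 1)) +
      b ^ p * (F (b * t) / (b * t) ^ (p + 1)) := by
  rw [hF, Real.mul_rpow ha.le ht.le, Real.mul_rpow hb.le ht.le, Real.rpow_add_one ha.ne',
    Real.rpow_add_one hb.ne']
  have := Real.rpow_pos_of_pos ha p
  have := Real.rpow_pos_of_pos hb p
  have := Real.rpow_pos_of_pos ht (p + 1)
  field_simp

/-- Harnack inequality for positive monotone solutions of `F t = F (a * t) / a + F (b * t) / b`. -/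
lemma exists_harnack_const {F : ℝ → ℝ} {a b p : ℝ} (ha : 0 < a) (ha1 : a < 1) (hb : 0 < b)
    (hb1 : b < 1) (hp : 0 < p) (hab : a ^ p + b ^ p = 1)
    (hmono : ∀ s t, 0 < s → s ≤ t → F s ≤ F t) (hpos : ∀ t, 0 < t → 0 < F t)
    (hF : ∀ t, 0 < t → F t = F (a * t) / a + F (b * t) / b) :
    ∃ C : ℝ, 0 < C ∧ ∀ s t, 0 < s → 0 < t → F s / s ^ (p + 1) ≤ C * (F t / t ^ (p + 1)) := by
  set m := min a b with hm
  set ρ := max a b with hρ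
  have hm0 : 0 < m := lt_min ha hb
  have hρ1 : ρ < 1 := max_lt ha1 hb1
  have hρ0 : 0 < ρ := lt_of_lt_of_le ha (le_max_left _ _)
  have hm1 : m < 1 := lt_of_le_of_lt (min_le_left _ _) ha1
  set K := 1 / a + 1 / b with hK
  have hK0 : 0 < K := by positivity
  obtain ⟨n, hn⟩ := exists_pow_lt_of_lt_one hm0 hρ1
  have hdoub : ∀ t, 0 < t → F t ≤ K * F (ρ * t) := by
    intro t ht
    rw [hF t ht, hK, add_mul, one_div_mul_eq_div, one_div_mul_eq_div]
    gcongr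
    · exact hmono _ _ (by positivity) (by gcongr; exact le_max_left _ _)
    · exact hmono _ _ (by positivity) (by gcongr; exact le_max_right _ _)
  have hiter : ∀ k : ℕ, ∀ t, 0 < t → F t ≤ K ^ k * F (ρ ^ k * t) := by
    intro k
    induction k with
    | zero => intro t _; simp
    | succ k ih =>
      intro t ht
      calc F t ≤ K ^ k * F (ρ ^ k * t) := ih t ht
        _ ≤ K ^ k * (K * F (ρ * (ρ ^ k * t))) := by
          gcongr
          exact hdoub _ (by positivity)
        _ = K ^ (k + 1) * F (ρ ^ (k + 1) * t) := by
          rw [show ρ * (ρ ^ k * t) = ρ ^ (k + 1) * t by ring]; ring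
  set G : ℝ → ℝ := fun t => F t / t ^ (p + 1) with hG
  have hGharm : ∀ t, 0 < t → G t = a ^ p * G (a * t) + b ^ p * G (b * t) :=
    fun t ht => div_rpow_add_one_eq ha hb ht (hF t ht)
  have hap := Real.rpow_pos_of_pos ha p
  have hbp := Real.rpow_pos_of_pos hb p
  have hmp := Real.rpow_pos_of_pos hm0 (p + 1)
  refine ⟨K ^ n / (m ^ (p + 1) * m ^ (p + 1)) * m ^ (p + 1), by positivity, fun s t hs ht => ?_⟩
  set ε := min s t with hε
  have hε0 : 0 < ε := lt_min hs ht
  have hεp := Real.rpow_pos_of_pos hε0 (p + 1)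
  have hmε : m * ε ≤ ε := by nlinarith
  have hupper : G s ≤ F ε / (m * ε) ^ (p + 1) := by
    refine le_of_le_on_window_of_harmonic hm0 (min_le_left _ _) (min_le_right _ _)
      (le_max_left _ _) (le_max_right _ _) hρ1 hε0 hap.le hbp.le hab hGharm ?_
      (hmε.trans (min_le_left _ _))
    intro u hu1 hu2
    have hu0 : 0 < u := lt_of_lt_of_le (by positivity) hu1
    simp only [hG]
    have := hpos ε hε0
    gcongr
    exact hmono _ _ hu0 hu2
  have hlower : F (m * ε) / ε ^ (p + 1) ≤ G t := by
    have := le_of_le_on_window_of_harmonic (G := fun t => -G t) (M := -(F (m * ε) / ε ^ (p + 1)))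
      hm0 (min_le_left a b) (min_le_right a b)
      (le_max_left a b) (le_max_right a b) hρ1 hε0 hap.le hbp.le hab
      (fun t ht => by rw [hGharm t ht]; ring) ?_
      (hmε.trans (min_le_right s t))
    · linarith
    intro u hu1 hu2
    have hu0 : 0 < u := lt_of_lt_of_le (by positivity) hu1
    simp only [hG]
    have := hpos u hu0
    refine neg_le_neg ?_
    gcongr
    exact hmono _ _ (by positivity) hu1
  have hcomp : F ε ≤ K ^ n * F (m * ε) := by
    refine (hiter n ε hε0).trans ?_
    gcongr
    exact hmono _ _ (by positivity) (by gcongr)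
  calc G s ≤ F ε / (m * ε) ^ (p + 1) := hupper
    _ ≤ K ^ n * F (m * ε) / (m * ε) ^ (p + 1) := by gcongr
    _ = K ^ n / (m ^ (p + 1) * m ^ (p + 1)) * m ^ (p + 1) * (F (m * ε) / ε ^ (p + 1)) := by
      rw [Real.mul_rpow hm0.le hε0.le]; field_simp
    _ ≤ _ := by gcongr

/-- If `G` lies between positive constants, then a harmonicity relation has total weight one. -/
lemma weights_sum_eq_one {G : ℝ → ℝ} {a b α β C : ℝ} (ha : 0 < a) (hb : 0 < b)
    (hα : 0 < α) (hβ : 0 < β) (hC : ∀ s t, 0 < s → 0 < t → G s ≤ C * G t)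
    (hpos : ∀ t, 0 < t → 0 < G t)
    (hG : ∀ t, 0 < t → G t = α * G (a * t) + β * G (b * t)) : α + β = 1 := by
  set T := G '' Set.Ioi 0 with hT
  have hne : T.Nonempty := ⟨G 1, 1, Set.mem_Ioi.2 one_pos, rfl⟩
  have hba : BddAbove T := ⟨C * G 1, by rintro _ ⟨x, hx, rfl⟩; exact hC x 1 hx one_pos⟩
  have hbb : BddBelow T := ⟨0, by rintro _ ⟨x, hx, rfl⟩; exact (hpos x hx).le⟩
  have hC0 : 0 < C := by
    have := hC 1 1 one_pos one_pos
    have h1 := hpos 1 one_pos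
    nlinarith
  have hinf : 0 < sInf T := by
    refine lt_of_lt_of_le (div_pos (hpos 1 one_pos) hC0) (le_csInf hne ?_)
    rintro _ ⟨x, hx, rfl⟩
    rw [div_le_iff₀ hC0, mul_comm]
    exact hC 1 x one_pos hx
  have hsup : 0 < sSup T := (hpos 1 one_pos).trans_le (le_csSup hba ⟨1, Set.mem_Ioi.2 one_pos, rfl⟩)
  have h1 : (α + β) * sInf T ≤ sInf T := by
    refine le_csInf hne ?_
    rintro _ ⟨x, hx, rfl⟩
    rw [Set.mem_Ioi] at hx
    rw [hG x hx, add_mul]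
    gcongr
    · exact csInf_le hbb ⟨a * x, mul_pos ha hx, rfl⟩
    · exact csInf_le hbb ⟨b * x, mul_pos hb hx, rfl⟩
  have h2 : sSup T ≤ (α + β) * sSup T := by
    refine csSup_le hne ?_
    rintro _ ⟨x, hx, rfl⟩
    rw [Set.mem_Ioi] at hx
    rw [hG x hx, add_mul]
    gcongr
    · exact le_csSup hba ⟨a * x, mul_pos ha hx, rfl⟩
    · exact le_csSup hba ⟨b * x, mul_pos hb hx, rfl⟩
  refine le_antisymm ?_ ?_
  · by_contra! h; nlinarith
  · by_contra! h; nlinarith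

lemma integral_zero_mono_of_nonneg {f : ℝ → ℝ} (hf : Continuous f) (hf0 : ∀ t, 0 ≤ f t) {s t : ℝ}
    (hs : 0 ≤ s) (hst : s ≤ t) : ∫ u in (0 : ℝ)..s, f u ≤ ∫ u in (0 : ℝ)..t, f u :=
  intervalIntegral.integral_mono_interval le_rfl hs hst (Filter.Eventually.of_forall hf0)
    (hf.intervalIntegrable _ _)

lemma integral_eq_of_add_comp_mul {f : ℝ → ℝ} (hf : Continuous f) {a b : ℝ} (ha : 0 < a)
    (hb : 0 < b) (hab : ∀ t, f t = f (a * t) + f (b * t)) (t : ℝ) :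
    ∫ u in (0 : ℝ)..t, f u =
      (∫ u in (0 : ℝ)..(a * t), f u) / a + (∫ u in (0 : ℝ)..(b * t), f u) / b := by
  have h1 : ∫ u in (0 : ℝ)..t, f u = ∫ u in (0 : ℝ)..t, (f (a * u) + f (b * u)) :=
    intervalIntegral.integral_congr fun u _ => hab u
  have h2 : ∀ x : ℝ, IntervalIntegrable (fun u => f (x * u)) volume 0 t := fun x =>
    (hf.comp (continuous_const_mul x)).intervalIntegrable _ _
  rw [h1, intervalIntegral.integral_add (h2 a) (h2 b),
    intervalIntegral.integral_comp_mul_left f ha.ne',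
    intervalIntegral.integral_comp_mul_left f hb.ne']
  simp [div_eq_inv_mul]

lemma exists_eq_mul_rpow_of_dense {f : ℝ → ℝ} (hf : Continuous f) (hf0 : ∀ t, 0 ≤ f t)
    (hfpos : ∀ t, 0 < t → 0 < ∫ u in (0 : ℝ)..t, f u) {S : Set {x : ℝ // 0 < x}}
    (hS : ∀ x ∈ S, ∃ a b : ℝ, 0 < a ∧ a < 1 ∧ 0 < b ∧ b < 1 ∧ (x : ℝ) = a / b ∧
      ∀ t, f t = f (a * t) + f (b * t))
    (hdense : ∀ y : ℝ, 0 < y → y ∈ closure (Subtype.val ''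
      (Subgroup.closure S : Set {x : ℝ // 0 < x}))) :
    ∃ p A : ℝ, 0 < p ∧ 0 < A ∧ ∀ t, 0 < t → f t = A * t ^ p := by
  have hne : S.Nonempty := by
    by_contra h
    rw [Set.not_nonempty_iff_eq_empty] at h
    have h2 := hdense 2 two_pos
    rw [h, Subgroup.closure_empty] at h2
    simp at h2
  set F : ℝ → ℝ := fun t => ∫ u in (0 : ℝ)..t, f u with hFdef
  have hmono : ∀ s t, 0 < s → s ≤ t → F s ≤ F t :=
    fun s t hs hst => integral_zero_mono_of_nonneg hf hf0 hs.le hst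
  have hderiv : ∀ t, HasDerivAt F (f t) t := fun t => hf.integral_hasStrictDerivAt 0 t |>.hasDerivAt
  obtain ⟨x, hx⟩ := hne
  obtain ⟨a, b, ha, ha1, hb, hb1, -, hfab⟩ := hS x hx
  obtain ⟨p, hp, hpab⟩ := exists_rpow_add_rpow_eq_one ha ha1 hb hb1
  obtain ⟨C, hC0, hC⟩ := exists_harnack_const ha ha1 hb hb1 hp hpab hmono hfpos
    fun t _ => integral_eq_of_add_comp_mul hf ha hb hfab t
  set G : ℝ → ℝ := fun t => F t / t ^ (p + 1) with hG
  have hGpos : ∀ t, 0 < t → 0 < G t := fun t ht =>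
    div_pos (hfpos t ht) (Real.rpow_pos_of_pos ht _)
  have hGcont : ∀ t, 0 < t → ContinuousAt G t := fun t ht =>
    (hderiv t).continuousAt.div (Real.continuousAt_rpow_const _ _ (Or.inl ht.ne'))
      (Real.rpow_pos_of_pos ht _).ne'
  have hper : ∀ x ∈ Subgroup.closure S, ∀ t, 0 < t → G (x * t) = G t := by
    intro x hx
    induction hx using Subgroup.closure_induction with
    | mem x hx =>
      intro t ht
      obtain ⟨a, b, ha, ha1, hb, hb1, hxab, hfab⟩ := hS x hx
      have hap := Real.rpow_pos_of_pos ha p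
      have hbp := Real.rpow_pos_of_pos hb p
      have hharm : ∀ t, 0 < t → G t = a ^ p * G (a * t) + b ^ p * G (b * t) := fun t ht =>
        div_rpow_add_one_eq ha hb ht (integral_eq_of_add_comp_mul hf ha hb hfab t)
      have hsum := weights_sum_eq_one ha hb hap hbp hC hGpos hharm
      have hbound : ∀ t, 0 < t → |G t| ≤ C * G 1 := fun t ht => by
        rw [abs_of_pos (hGpos t ht)]
        exact hC t 1 ht one_pos
      have h1 := comp_mul_eq_of_bounded_of_harmonic ha hb hap hbp hsum hharm hbound
        (div_pos ht hb)
      have h2 := comp_mul_eq_of_bounded_of_harmonic (G := G) hb ha hbp hap (by linarith)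
        (fun t ht => by rw [hharm t ht, add_comm]) hbound (div_pos ht hb)
      rw [mul_div_cancel₀ t hb.ne'] at h2
      rw [hxab, div_mul_eq_mul_div, mul_div_assoc, h1, h2]
    | one => intro t _; simp
    | mul x y _ _ ihx ihy =>
      intro t ht
      rw [Positive.val_mul, mul_assoc, ihx _ (mul_pos y.2 ht), ihy t ht]
    | inv x _ ihx =>
      intro t ht
      have hx : (0 : ℝ) < ((x⁻¹ : {x : ℝ // 0 < x}) : ℝ) := (x⁻¹).2
      rw [← ihx _ (mul_pos hx ht), ← mul_assoc, ← Positive.val_mul, mul_inv_cancel]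
      simp
  have hconst : ∀ y, 0 < y → G y = G 1 := by
    intro y hy
    obtain ⟨u, hu, hlim⟩ := mem_closure_iff_seq_limit.1 (hdense y hy)
    refine tendsto_nhds_unique ((hGcont y hy).tendsto.comp hlim) ?_
    refine tendsto_const_nhds.congr fun n => ?_
    obtain ⟨x, hx, hxu⟩ := hu n
    rw [Function.comp_apply, ← hxu, ← hper x hx 1 one_pos, mul_one]
  refine ⟨p, G 1 * (p + 1), hp, mul_pos (hGpos 1 one_pos) (by linarith), fun t ht => ?_⟩
  have hFeq : ∀ y, 0 < y → F y = G 1 * y ^ (p + 1) := by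
    intro y hy
    rw [← hconst y hy]
    exact (div_mul_cancel₀ _ (Real.rpow_pos_of_pos hy _).ne').symm
  have hd1 : HasDerivAt (fun y : ℝ => G 1 * y ^ (p + 1)) (G 1 * ((p + 1) * t ^ (p + 1 - 1))) t :=
    (Real.hasDerivAt_rpow_const (Or.inl ht.ne')).const_mul _
  have hd2 := hd1.congr_of_eventuallyEq
    ((eventually_gt_nhds ht).mono fun y hy => hFeq y hy)
  rw [(hderiv t).unique hd2, add_sub_cancel_right, mul_assoc]

section CharFun

variable {μ : Measure ℝ} {φ : ℝ → ℝ}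

lemma integrable_cos_mul [IsProbabilityMeasure μ] (t : ℝ) :
    Integrable (fun x => Real.cos (t * x)) μ :=
  Integrable.of_bound (by fun_prop) 1
    (Filter.Eventually.of_forall fun x => by simpa using Real.abs_cos_le_one _)

lemma eq_integral_cos [IsProbabilityMeasure μ] (hφ : ∀ t : ℝ, (φ t : ℂ) = charFunOf μ t) (t : ℝ) :
    φ t = ∫ x, Real.cos (t * x) ∂μ := by
  have h : Integrable (fun x : ℝ => Complex.exp (t * x * Complex.I)) μ := by
    refine Integrable.of_bound (by fun_prop) 1 (Filter.Eventually.of_forall fun x => ?_)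
    rw [← Complex.ofReal_mul, Complex.norm_exp_ofReal_mul_I]
  have h1 := congrArg Complex.re (hφ t)
  rw [Complex.ofReal_re, charFunOf] at h1
  have h2 := integral_re h
  simp only [RCLike.re_eq_complex_re] at h2
  rw [h1, ← h2]
  refine integral_congr_ae (Filter.Eventually.of_forall fun x => ?_)
  simp only [← Complex.ofReal_mul, Complex.exp_ofReal_mul_I_re]

lemma continuous_of_eq_charFunOf [IsProbabilityMeasure μ]
    (hφ : ∀ t : ℝ, (φ t : ℂ) = charFunOf μ t) : Continuous φ := by
  rw [funext (eq_integral_cos hφ)]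
  refine continuous_of_dominated (bound := fun _ => 1) (fun t => by fun_prop)
    (fun t => Filter.Eventually.of_forall fun x => by simpa using Real.abs_cos_le_one _)
    (integrable_const 1) (Filter.Eventually.of_forall fun x => by fun_prop)

lemma abs_le_one_of_eq_charFunOf [IsProbabilityMeasure μ]
    (hφ : ∀ t : ℝ, (φ t : ℂ) = charFunOf μ t) (t : ℝ) : |φ t| ≤ 1 := by
  rw [eq_integral_cos hφ]
  have := norm_integral_le_of_norm_le_const (μ := μ) (f := fun x => Real.cos (t * x)) (C := 1)
    (Filter.Eventually.of_forall fun x => by simpa using Real.abs_cos_le_one _)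
  simpa using this

lemma map_zero_of_eq_charFunOf [IsProbabilityMeasure μ]
    (hφ : ∀ t : ℝ, (φ t : ℂ) = charFunOf μ t) : φ 0 = 1 := by
  simp [eq_integral_cos hφ]

lemma map_neg_of_eq_charFunOf [IsProbabilityMeasure μ]
    (hφ : ∀ t : ℝ, (φ t : ℂ) = charFunOf μ t) (t : ℝ) : φ (-t) = φ t := by
  simp [eq_integral_cos hφ]

lemma one_sub_map_two_mul_le [IsProbabilityMeasure μ]
    (hφ : ∀ t : ℝ, (φ t : ℂ) = charFunOf μ t) (t : ℝ) : 1 - φ (2 * t) ≤ 4 * (1 - φ t) := by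
  have h : φ t * 4 - 3 ≤ φ (2 * t) := by
    rw [eq_integral_cos hφ, eq_integral_cos hφ, ← integral_mul_const]
    have h3 : ∫ _ : ℝ, (3 : ℝ) ∂μ = 3 := by simp
    rw [← h3, ← integral_sub ((integrable_cos_mul t).mul_const 4) (integrable_const 3)]
    refine integral_mono (((integrable_cos_mul t).mul_const 4).sub (integrable_const 3))
      (integrable_cos_mul _) fun x => ?_
    simp only [mul_assoc 2 t x, Real.cos_two_mul]
    nlinarith [sq_nonneg (Real.cos (t * x) - 1)]
  linarith

lemma eq_one_of_eq_one_near_zero [IsProbabilityMeasure μ]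
    (hφ : ∀ t : ℝ, (φ t : ℂ) = charFunOf μ t) (h : ∀ᶠ t in nhds 0, φ t = 1) (t : ℝ) :
    φ t = 1 := by
  have hlim : Filter.Tendsto (fun n : ℕ => (1 / 2 : ℝ) ^ n * t) Filter.atTop (nhds 0) := by
    simpa using (tendsto_pow_atTop_nhds_zero_of_lt_one (by norm_num : (0 : ℝ) ≤ 1 / 2)
      (by norm_num)).mul_const t
  obtain ⟨n, hn⟩ := (hlim.eventually h).exists
  have key : ∀ n : ℕ, ∀ s, φ ((1 / 2 : ℝ) ^ n * s) = 1 → φ s = 1 := by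
    intro n
    induction n with
    | zero => intro s hs; simpa using hs
    | succ n ih =>
      intro s hs
      refine ih s ?_
      have h1 := one_sub_map_two_mul_le hφ ((1 / 2 : ℝ) ^ (n + 1) * s)
      rw [hs, show 2 * ((1 / 2 : ℝ) ^ (n + 1) * s) = (1 / 2 : ℝ) ^ n * s by ring] at h1
      have h2 := (abs_le.1 (abs_le_one_of_eq_charFunOf hφ ((1 / 2 : ℝ) ^ n * s))).2
      linarith
  exact key n t hn

lemma eventually_pos_near_zero [IsProbabilityMeasure μ]
    (hφ : ∀ t : ℝ, (φ t : ℂ) = charFunOf μ t) : ∀ᶠ t in nhds 0, 0 < φ t := by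
  refine (continuous_of_eq_charFunOf hφ).continuousAt.eventually (lt_mem_nhds ?_)
  rw [map_zero_of_eq_charFunOf hφ]
  exact one_pos

lemma eq_one_of_one_le_abs [IsProbabilityMeasure μ]
    (hφ : ∀ t : ℝ, (φ t : ℂ) = charFunOf μ t) (h : ∀ t, 1 ≤ |φ t|) (t : ℝ) : φ t = 1 := by
  refine eq_one_of_eq_one_near_zero hφ ((eventually_pos_near_zero hφ).mono fun s hs => ?_) t
  rw [← abs_of_pos hs]
  exact le_antisymm (abs_le_one_of_eq_charFunOf hφ s) (h s)

lemma lt_one_of_mul_eq [IsProbabilityMeasure μ] (hφ : ∀ t : ℝ, (φ t : ℂ) = charFunOf μ t)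
    (hnt : ∃ t, φ t ≠ 1) {a b : ℝ} (hb : 0 < b)
    (hab : ∀ t, φ (a * t) * φ (b * t) = φ t) : a < 1 := by
  by_contra! ha
  obtain ⟨t₀, ht₀⟩ := hnt
  refine ht₀ ?_
  rcases ha.eq_or_lt with rfl | ha
  · have h1 : ∀ᶠ t in nhds 0, φ (b * t) = 1 := by
      filter_upwards [eventually_pos_near_zero hφ] with t ht
      have := hab t
      rw [one_mul] at this
      exact mul_left_cancel₀ ht.ne' (by rw [this, mul_one])
    have hlim : Filter.Tendsto (fun t : ℝ => b⁻¹ * t) (nhds 0) (nhds 0) := by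
      simpa using (continuous_const_mul b⁻¹).tendsto (0 : ℝ)
    refine eq_one_of_eq_one_near_zero hφ ((hlim.eventually h1).mono fun t ht => ?_) t₀
    rwa [mul_inv_cancel_left₀ hb.ne'] at ht
  · refine eq_one_of_one_le_abs hφ (fun t => ?_) t₀
    have hstep : ∀ s, |φ s| ≤ |φ (a * s)| := by
      intro s
      rw [← hab s, abs_mul]
      exact mul_le_of_le_one_right (abs_nonneg _) (abs_le_one_of_eq_charFunOf hφ _)
    have hiter : ∀ n : ℕ, |φ (a⁻¹ ^ n * t)| ≤ |φ t| := by
      intro n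
      induction n with
      | zero => simp
      | succ n ih =>
        refine (hstep _).trans ?_
        rwa [pow_succ', mul_assoc, mul_inv_cancel_left₀ (by positivity)]
    have hlim : Filter.Tendsto (fun n : ℕ => a⁻¹ ^ n * t) Filter.atTop (nhds 0) := by
      simpa using (tendsto_pow_atTop_nhds_zero_of_lt_one (by positivity)
        (inv_lt_one_of_one_lt₀ ha)).mul_const t
    have := ((continuous_of_eq_charFunOf hφ).abs.tendsto 0).comp hlim
    rw [map_zero_of_eq_charFunOf hφ, abs_one] at this
    exact le_of_tendsto this (Filter.Eventually.of_forall hiter)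

lemma pos_of_mul_eq [IsProbabilityMeasure μ] (hφ : ∀ t : ℝ, (φ t : ℂ) = charFunOf μ t)
    {a b : ℝ} (ha : 0 < a) (ha1 : a < 1) (hb : 0 < b) (hb1 : b < 1)
    (hab : ∀ t, φ (a * t) * φ (b * t) = φ t) (t : ℝ) : 0 < φ t := by
  by_contra! ht
  set ρ := max a b with hρ
  have hρ0 : 0 < ρ := lt_of_lt_of_le ha (le_max_left _ _)
  have hρ1 : ρ < 1 := max_lt ha1 hb1
  have hdesc : ∀ n : ℕ, ∃ s, |s| ≤ ρ ^ n * |t| ∧ φ s ≤ 0 := by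
    intro n
    induction n with
    | zero => exact ⟨t, by simp, ht⟩
    | succ n ih =>
      obtain ⟨s, hs, hs0⟩ := ih
      have aux : ∀ x, 0 < x → x ≤ ρ → |x * s| ≤ ρ ^ (n + 1) * |t| := by
        intro x hx hxρ
        rw [abs_mul, abs_of_pos hx, pow_succ', mul_assoc]
        gcongr
      by_cases h1 : φ (a * s) ≤ 0
      · exact ⟨a * s, aux a ha (le_max_left _ _), h1⟩
      · by_cases h2 : φ (b * s) ≤ 0
        · exact ⟨b * s, aux b hb (le_max_right _ _), h2⟩
        · push Not at h1 h2
          have := mul_pos h1 h2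
          rw [hab s] at this
          linarith
  choose s hs hs0 using hdesc
  have hlim : Filter.Tendsto (fun n : ℕ => ρ ^ n * |t|) Filter.atTop (nhds 0) := by
    simpa using (tendsto_pow_atTop_nhds_zero_of_lt_one hρ0.le hρ1).mul_const |t|
  have hs' : Filter.Tendsto s Filter.atTop (nhds 0) := squeeze_zero_norm hs hlim
  obtain ⟨n, hn⟩ := (hs'.eventually (eventually_pos_near_zero hφ)).exists
  exact absurd hn (not_lt.2 (hs0 n))

lemma integral_neg_log_pos [IsProbabilityMeasure μ] (hφ : ∀ t : ℝ, (φ t : ℂ) = charFunOf μ t)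
    (hnt : ∃ t, φ t ≠ 1) (hpos : ∀ t, 0 < φ t) {t : ℝ} (ht : 0 < t) :
    0 < ∫ u in (0 : ℝ)..t, -Real.log (φ u) := by
  have hcont : Continuous fun u => -Real.log (φ u) :=
    ((continuous_of_eq_charFunOf hφ).log fun u => (hpos u).ne').neg
  have hnn : ∀ u, 0 ≤ -Real.log (φ u) := fun u => by
    have := Real.log_nonpos (hpos u).le (abs_le.1 (abs_le_one_of_eq_charFunOf hφ u)).2
    linarith
  by_contra! hle
  have hone : ∀ u ∈ Set.Ioo 0 t, φ u = 1 := by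
    intro u hu
    by_contra hne
    have hlog : Real.log (φ u) ≠ 0 := Real.log_ne_zero_of_pos_of_ne_one (hpos u) hne
    refine absurd (intervalIntegral.integral_pos ht hcont.continuousOn (fun u _ => hnn u)
      ⟨u, ⟨hu.1.le, hu.2.le⟩, lt_of_le_of_ne (hnn u) ?_⟩) (not_lt.2 hle)
    exact fun h => hlog (by linarith)
  obtain ⟨u, hu⟩ := hnt
  refine hu (eq_one_of_eq_one_near_zero hφ ?_ u)
  filter_upwards [Ioo_mem_nhds (neg_lt_zero.2 ht) ht] with s hs
  rcases lt_trichotomy s 0 with h | rfl | h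
  · rw [← map_neg_of_eq_charFunOf hφ]
    exact hone (-s) ⟨by linarith, by linarith [hs.1]⟩
  · exact map_zero_of_eq_charFunOf hφ
  · exact hone s ⟨h, hs.2⟩

lemma exponent_le_two [IsProbabilityMeasure μ] (hφ : ∀ t : ℝ, (φ t : ℂ) = charFunOf μ t)
    {p A : ℝ} (hp : 0 < p) (hA : 0 < A) (h : ∀ t : ℝ, φ t = Real.exp (-(A * |t| ^ p))) :
    p ≤ 2 := by
  set q : ℝ := 2 ^ p with hq
  have hq0 : 0 < q := Real.rpow_pos_of_pos two_pos p
  have hx : ∀ x : ℝ, 0 < x → q ≤ 4 + 4 * (q * x) := by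
    intro x hx
    set t := (x / A) ^ p⁻¹ with ht
    have ht0 : 0 < t := Real.rpow_pos_of_pos (by positivity) _
    have htp : A * |t| ^ p = x := by
      rw [abs_of_pos ht0, ht, Real.rpow_inv_rpow (by positivity) hp.ne']
      field_simp
    have h2tp : A * |2 * t| ^ p = q * x := by
      rw [abs_mul, abs_two, Real.mul_rpow two_pos.le (abs_nonneg _), ← htp]
      ring
    have h1 := one_sub_map_two_mul_le hφ t
    rw [h, h, htp, h2tp] at h1
    have h2 : Real.exp (-(q * x)) ≤ 1 / (1 + q * x) := by
      rw [Real.exp_neg, ← one_div]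
      have := Real.add_one_le_exp (q * x)
      gcongr
      linarith
    have h3 := Real.add_one_le_exp (-x)
    have h4 : 1 - 1 / (1 + q * x) ≤ 4 * x := by linarith
    have h5 : 1 - 1 / (1 + q * x) = q * x / (1 + q * x) := by field_simp; ring
    rw [h5, div_le_iff₀ (by positivity)] at h4
    exact le_of_mul_le_mul_right (by linarith) hx
  have hq4 : q ≤ 4 := by
    by_contra! hlt
    have := hx ((q - 4) / (8 * q)) (div_pos (by linarith) (by positivity))
    rw [show 4 * (q * ((q - 4) / (8 * q))) = (q - 4) / 2 by field_simp; ring] at this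
    linarith
  have : (2 : ℝ) ^ p ≤ 2 ^ (2 : ℝ) := by
    rw [Real.rpow_two]
    linarith
  exact (Real.rpow_le_rpow_left_iff one_lt_two).1 this

end CharFun

theorem stmt_9 (c d : ℝ → ℝ → ℝ)
    (hc : ∀ r s : ℝ, 0 ≤ r → 0 ≤ s → 0 ≤ c r s)
    (hd : ∀ r s : ℝ, 0 ≤ r → 0 ≤ s → 0 ≤ d r s)
    (hdpos : ∃ r s : ℝ, 0 < r ∧ 0 < s ∧ 0 < d r s)
    -- the multiplicative subgroup of `(0,∞)` generated by `{r/s : (r,s) ∈ Z}`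
    -- is dense in `(0,∞)`:
    (hdense : ∀ y : ℝ, 0 < y → y ∈ closure (Subtype.val ''
      ((Subgroup.closure {x : {x : ℝ // 0 < x} |
        ∃ r s : ℝ, 0 < r ∧ 0 < s ∧ d r s = 0 ∧ (x : ℝ) = r / s}) :
        Set {x : ℝ // 0 < x})))
    (φ ψ : ℝ → ℝ) (μ ν : Measure ℝ)
    (hμ : IsProbabilityMeasure μ) (hν : IsProbabilityMeasure ν)
    (hφ : ∀ t : ℝ, (φ t : ℂ) = charFunOf μ t)
    (hψ : ∀ t : ℝ, (ψ t : ℂ) = charFunOf ν t)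
    (hφnt : ∃ t : ℝ, φ t ≠ 1) (hψnt : ∃ t : ℝ, ψ t ≠ 1)
    (heq : ∀ r s t : ℝ, 0 ≤ r → 0 ≤ s →
      φ (r * t) * φ (s * t) = φ (c r s * t) * ψ (d r s * t)) :
    ∃ p A B : ℝ, 0 < p ∧ p ≤ 2 ∧ 0 < A ∧ 0 < B ∧
      (∀ t : ℝ, φ t = Real.exp (-(A * |t| ^ p))) ∧
      (∀ t : ℝ, ψ t = Real.exp (-(B * |t| ^ p))) ∧
      (∀ r s : ℝ, 0 ≤ r → 0 ≤ s →
        A * (r ^ p + s ^ p - (c r s) ^ p) = B * (d r s) ^ p) := by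
  have hφ0 := map_zero_of_eq_charFunOf hφ
  have hψ0 := map_zero_of_eq_charFunOf hψ
  have hcontr : ∀ r s : ℝ, 0 < r → 0 < s → d r s = 0 → ∃ a b : ℝ, 0 < a ∧ a < 1 ∧ 0 < b ∧
      b < 1 ∧ r / s = a / b ∧ ∀ t, φ (a * t) * φ (b * t) = φ t := by
    intro r s hr hs hdrs
    have hrs : ∀ t, φ (r * t) * φ (s * t) = φ (c r s * t) := by
      intro t
      rw [heq r s t hr.le hs.le, hdrs, zero_mul, hψ0, mul_one]
    have hc0 : c r s ≠ 0 := by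
      intro hc0
      obtain ⟨t₀, ht₀⟩ := hφnt
      refine ht₀ (eq_one_of_one_le_abs hφ (fun t => ?_) t₀)
      have h1 := hrs (t / r)
      rw [hc0, zero_mul, hφ0, mul_div_cancel₀ t hr.ne'] at h1
      have h2 := congrArg abs h1
      rw [abs_mul, abs_one] at h2
      rw [← h2]
      exact mul_le_of_le_one_right (abs_nonneg _) (abs_le_one_of_eq_charFunOf hφ _)
    have hcpos : 0 < c r s := lt_of_le_of_ne (hc r s hr.le hs.le) hc0.symm
    have hab : ∀ t, φ (r / c r s * t) * φ (s / c r s * t) = φ t := by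
      intro t
      have := hrs (t / c r s)
      rw [mul_div_cancel₀ t hc0] at this
      rw [← this]
      congr 2 <;> ring
    refine ⟨r / c r s, s / c r s, by positivity,
      lt_one_of_mul_eq hφ hφnt (div_pos hs hcpos) hab, by positivity,
      lt_one_of_mul_eq hφ hφnt (div_pos hr hcpos) (fun t => by rw [mul_comm, hab]),
      by field_simp, hab⟩
  have hZ : ∃ r s : ℝ, 0 < r ∧ 0 < s ∧ d r s = 0 := by
    by_contra! hZ
    have h2 := hdense 2 two_pos
    rw [Set.eq_empty_of_forall_notMem (s := {x : {x : ℝ // 0 < x} |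
        ∃ r s : ℝ, 0 < r ∧ 0 < s ∧ d r s = 0 ∧ (x : ℝ) = r / s})
      (by rintro x ⟨r, s, hr, hs, hdrs, -⟩; exact hZ r s hr hs hdrs),
      Subgroup.closure_empty] at h2
    simp at h2
  have hpos : ∀ t, 0 < φ t := by
    obtain ⟨r, s, hr, hs, hdrs⟩ := hZ
    obtain ⟨a, b, ha, ha1, hb, hb1, -, hab⟩ := hcontr r s hr hs hdrs
    exact pos_of_mul_eq hφ ha ha1 hb hb1 hab
  obtain ⟨p, A, hp, hA, hfA⟩ := exists_eq_mul_rpow_of_dense (f := fun t => -Real.log (φ t))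
    (((continuous_of_eq_charFunOf hφ).log fun u => (hpos u).ne').neg)
    (fun t => neg_nonneg.2 (Real.log_nonpos (hpos t).le
      (abs_le.1 (abs_le_one_of_eq_charFunOf hφ t)).2))
    (fun t ht => integral_neg_log_pos hφ hφnt hpos ht)
    (by
      rintro x ⟨r, s, hr, hs, hdrs, hx⟩
      obtain ⟨a, b, ha, ha1, hb, hb1, hrs, hab⟩ := hcontr r s hr hs hdrs
      refine ⟨a, b, ha, ha1, hb, hb1, hx.trans hrs, fun t => ?_⟩
      rw [← hab t, Real.log_mul (hpos _).ne' (hpos _).ne']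
      ring) hdense
  have hφexp : ∀ t : ℝ, φ t = Real.exp (-(A * |t| ^ p)) := by
    have hposcase : ∀ t : ℝ, 0 < t → φ t = Real.exp (-(A * |t| ^ p)) := by
      intro t ht
      rw [abs_of_pos ht, ← hfA t ht, neg_neg, Real.exp_log (hpos t)]
    intro t
    rcases lt_trichotomy t 0 with h | rfl | h
    · rw [← map_neg_of_eq_charFunOf hφ, hposcase (-t) (by linarith), abs_neg]
    · simp [hφ0, Real.zero_rpow hp.ne']
    · exact hposcase t h
  have hψexp : ∀ r s t : ℝ, 0 ≤ r → 0 ≤ s →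
      ψ (d r s * t) = Real.exp (-(A * (r ^ p + s ^ p - (c r s) ^ p) * |t| ^ p)) := by
    intro r s t hr hs
    have h1 := heq r s t hr hs
    rw [hφexp, hφexp, hφexp, ← Real.exp_add, abs_mul, abs_mul, abs_mul, abs_of_nonneg hr,
      abs_of_nonneg hs, abs_of_nonneg (hc r s hr hs), Real.mul_rpow hr (abs_nonneg t),
      Real.mul_rpow hs (abs_nonneg t), Real.mul_rpow (hc r s hr hs) (abs_nonneg t)] at h1
    refine mul_left_cancel₀ (Real.exp_pos _).ne' (h1.symm.trans ?_)
    rw [← Real.exp_add]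
    congr 1
    ring
  obtain ⟨r, s, hr, hs, hdrs⟩ := hdpos
  set B := A * (r ^ p + s ^ p - (c r s) ^ p) / (d r s) ^ p with hB
  have hψB : ∀ t : ℝ, ψ t = Real.exp (-(B * |t| ^ p)) := by
    intro t
    have h1 := hψexp r s (t / d r s) hr.le hs.le
    rw [mul_div_cancel₀ t hdrs.ne'] at h1
    rw [h1, abs_div, abs_of_pos hdrs, Real.div_rpow (abs_nonneg t) hdrs.le, hB]
    congr 1
    ring
  have hBpos : 0 < B := by
    obtain ⟨t, ht⟩ := hψnt
    have h1 := (abs_le.1 (abs_le_one_of_eq_charFunOf hψ 1)).2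
    rw [hψB, abs_one, Real.one_rpow, Real.exp_le_one_iff] at h1
    refine lt_of_le_of_ne (by linarith) fun h0 => ht ?_
    rw [hψB, ← h0]
    simp
  refine ⟨p, A, B, hp, exponent_le_two hφ hp hA hφexp, hA, hBpos, hφexp, hψB, ?_⟩
  intro r s hr hs
  have h1 := hψexp r s 1 hr hs
  rw [hψB, mul_one, abs_of_nonneg (hd r s hr hs), abs_one, Real.one_rpow, mul_one] at h1
  linarith [Real.exp_injective h1]
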